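/- Let I be an index structure, φ(x,y) a formula, and q a complete quantifier-free type of I. If φ admits a q-inconsistent I-dividing chain of length ω, then for every ordinal α, φ admits a q-inconsistent I-dividing chain of length α. -/

import Mathlib

/- Common definitions for formalizing "Tree properties for colored linear orders". -/

open FirstOrder FirstOrder.Language Cardinal

universe u v

namespace PaperTP

/-- Two tuples (possibly in two different structures of the same language) have the same
complete quantifier-free type. -/
def qfTypeEq (L' : FirstOrder.Language.{u, u}) {A : Type u} {B : Type u} [L'.Structure A] [L'.Structure B]
    {n : ℕ} (t : Fin n → A) (s : Fin n → B) : Prop :=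
  ∀ φ : L'.Formula (Fin n), BoundedFormula.IsQF φ →
    (Formula.Realize φ t ↔ Formula.Realize φ s)

/-- An elementary extension of the `L`-structure `M`, bundled. -/
structure ElemExtension (L : FirstOrder.Language.{u, u}) (M : Type u) [L.Structure M] :
    Type (u + 1) where
  carrier : Type u
  str : L.Structure carrier
  emb : @Language.ElementaryEmbedding L M carrier _ str

/-- A family of formulas `φs i (x, aₛ i)` (with parameters substituted for the `β`-variables) is
consistent: it is realized in some elementary extension of `M` (equivalently, it is finitely
satisfiable). -/
def Consistent {L : FirstOrder.Language.{u, u}} {M : Type u} [L.Structure M] {α β : Type} {ι : Type v}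
    (φs : ι → L.Formula (α ⊕ β)) (as : ι → β → M) : Prop :=
  ∃ E : ElemExtension L M,
    letI := E.str
    ∃ x : α → E.carrier, ∀ i, Formula.Realize (φs i) (Sum.elim x fun j => E.emb.toFun (as i j))

/-- `(a i)_{i ∈ I}` is an `I`-indexed indiscernible family of `β`-tuples in `M`. -/
def IndexedIndiscernible (L' : FirstOrder.Language.{u, u}) (I : Type u) [L'.Structure I]
    {L : FirstOrder.Language.{u, u}} {M : Type u} [L.Structure M] {β : Type} (a : I → β → M) : Prop :=
  ∀ (n : ℕ) (t s : Fin n → I), qfTypeEq L' t s →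
    ∀ φ : L.Formula (Fin n × β),
      (Formula.Realize φ fun p => a (t p.1) p.2) ↔ Formula.Realize φ fun p => a (s p.1) p.2

/-- `(a i)_{i ∈ I}` is an `I`-indexed indiscernible family of `β`-tuples in `M`, over the
parameter set `Cset`. -/
def IndexedIndiscernibleOver (L' : FirstOrder.Language.{u, u}) (I : Type u) [L'.Structure I]
    {L : FirstOrder.Language.{u, u}} {M : Type u} [L.Structure M] {β : Type}
    (Cset : Set M) (a : I → β → M) : Prop :=
  ∀ (n k : ℕ) (t s : Fin n → I) (c : Fin k → M), (∀ j, c j ∈ Cset) → qfTypeEq L' t s →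
    ∀ φ : L.Formula (Fin n × β ⊕ Fin k),
      (Formula.Realize φ (Sum.elim (fun p => a (t p.1) p.2) c) ↔
        Formula.Realize φ (Sum.elim (fun p => a (s p.1) p.2) c))

/-- The family `(b j)_{j ∈ J}` (in `N`) is locally based on the family `(a i)_{i ∈ I}` (in `M`):
for every finite set `Δ` of formulas and finite tuple `t` of indices from `J` there is a tuple `s`
of indices from `I` with the same complete quantifier-free type such that the `Δ`-types match. -/
def LocallyBased (L' : FirstOrder.Language.{u, u}) {J I : Type u} [L'.Structure J] [L'.Structure I]
    {L : FirstOrder.Language.{u, u}} {M N : Type u} [L.Structure M] [L.Structure N] {β : Type}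
    (b : J → β → N) (a : I → β → M) : Prop :=
  ∀ (n : ℕ) (Δ : Set (L.Formula (Fin n × β))), Δ.Finite → ∀ t : Fin n → J,
    ∃ s : Fin n → I, qfTypeEq L' t s ∧
      ∀ φ ∈ Δ, ((Formula.Realize φ fun p => b (t p.1) p.2) ↔
        Formula.Realize φ fun p => a (s p.1) p.2)

/-- `I`-indexed indiscernibles have the modeling property: every `I`-indexed family of tuples in
any structure `M` admits an `I`-indexed indiscernible family, in some elementary extension of `M`,
locally based on it. -/
def ModelingProperty (L' : FirstOrder.Language.{u, u}) (I : Type u) [L'.Structure I] : Prop :=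
  ∀ (L : FirstOrder.Language.{u, u}) (M : Type u) (S : L.Structure M),
    letI := S
    ∀ (β : Type) (a : I → β → M),
      ∃ E : ElemExtension L M,
        letI := E.str
        ∃ b : I → β → E.carrier,
          IndexedIndiscernible (L := L) L' I b ∧
            LocallyBased (L := L) L' b fun i x => E.emb.toFun (a i x)

/-- A Ramsey index structure: a locally finite structure with a relation symbol interpreted as a
linear (strict total) order, whose indexed indiscernibles have the modeling property. -/
def IsRamseyIndex (L' : FirstOrder.Language.{u, u}) (I : Type u) [L'.Structure I]
    (lt : L'.Relations 2) : Prop :=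
  IsStrictTotalOrder I (fun a b => Structure.RelMap lt ![a, b]) ∧
  (∀ s : Set I, s.Finite →
    Set.Finite ((Substructure.closure L' s : L'.Substructure I) : Set I)) ∧
  ModelingProperty L' I

/-! ### Colored linear orders -/

/-- The language of `κ`-colored linear orders: a binary order relation and a unary predicate for
each color in `κ`. -/
def colLang (κ : Type u) : FirstOrder.Language.{u, u} where
  Functions := fun _ => PEmpty
  Relations := fun n =>
    match n with
    | 1 => κ
    | 2 => PUnit
    | _ => PEmpty

/-- The order symbol of the colored linear order language. -/
def ltSym (κ : Type u) : (colLang κ).Relations 2 := PUnit.unit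

/-- The color predicates of the colored linear order language. -/
def colSym {κ : Type u} (c : κ) : (colLang κ).Relations 1 := c

/-- The order of a structure in the colored linear order language. -/
def cLT (κ : Type u) {C : Type u} [(colLang κ).Structure C] (x y : C) : Prop :=
  Structure.RelMap (ltSym κ) ![x, y]

/-- `x` has color `c` in a structure for the colored linear order language. -/
def HasColor (κ : Type u) {C : Type u} [(colLang κ).Structure C] (c : κ) (x : C) : Prop :=
  Structure.RelMap (colSym c) ![x]

/-- `C` is (up to isomorphism) the colored linear order `c_κ`, i.e. the Fraïssé limit of the class
of finite linear orders whose domain is partitioned into colors from `κ`: it is a countable,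
ultrahomogeneous, colored linear order into which every finite `κ`-colored linear order embeds. -/
structure IsColoredLimit (κ C : Type u) [(colLang κ).Structure C] : Prop where
  strict : IsStrictTotalOrder C (cLT κ)
  partition : ∀ x : C, ∃! c : κ, HasColor κ c x
  countable : Countable C
  ageFull : ∀ (n : ℕ) (pat : Fin n → κ), ∃ f : Fin n → C,
    (∀ i j : Fin n, i < j → cLT κ (f i) (f j)) ∧ ∀ i, HasColor κ (pat i) (f i)
  ultrahomogeneous : ∀ (n : ℕ) (s t : Fin n → C), qfTypeEq (colLang κ) s t →
    ∃ g : C ≃[colLang κ] C, ∀ i, g (s i) = t i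

/-! ### Tree properties -/

/-- The family of formulas `φ (x, f i)`, indexed by `i ∈ C`, is `q`-inconsistent, where the
complete quantifier-free type `q` is represented by a tuple realizing it in `C`: whenever a tuple
`t` of indices realizes `q`, the corresponding finite set of formulas is inconsistent. -/
def QInconsistent (L' : FirstOrder.Language.{u, u}) {C : Type u} [L'.Structure C]
    {L : FirstOrder.Language.{u, u}} {M : Type u} [L.Structure M] {α β : Type} {k : ℕ}
    (φ : L.Formula (α ⊕ β)) (q : Fin k → C) (f : C → β → M) : Prop :=
  ∀ t : Fin k → C, qfTypeEq L' q t →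
    ¬ Consistent (fun _ : Fin k => φ) fun j => f (t j)

/-- `φ` has the `I`-tree property witnessed by the complete quantifier-free type of the tuple `q`:
there is a tree of parameters indexed by `I^{<ω}` all of whose branches are consistent and all of
whose families of immediate successors are `q`-inconsistent. -/
def HasITPWith (L' : FirstOrder.Language.{u, u}) (C : Type u) [L'.Structure C]
    {L : FirstOrder.Language.{u, u}} {M : Type u} [L.Structure M] {α β : Type} {k : ℕ}
    (φ : L.Formula (α ⊕ β)) (q : Fin k → C) : Prop :=
  ∃ a : List C → β → M,
    (∀ b : ℕ → C, Consistent (fun _ : ℕ => φ) fun n => a (List.ofFn fun i : Fin n => b i)) ∧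
    (∀ η : List C, QInconsistent L' φ q fun i => a (η ++ [i]))

/-- `φ` has the `I`-tree property (`I`-TP), for the index structure `C`. -/
def HasITP (L' : FirstOrder.Language.{u, u}) (C : Type u) [L'.Structure C]
    {L : FirstOrder.Language.{u, u}} {M : Type u} [L.Structure M] {α β : Type}
    (φ : L.Formula (α ⊕ β)) : Prop :=
  ∃ (k : ℕ) (q : Fin k → C), HasITPWith L' C (M := M) φ q

/-- `φ` has `I`-TP₂ witnessed by the complete quantifier-free type of the tuple `q`: there is an
array of parameters, with rows indexed by `C`, such that all paths are consistent while every row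
is `q`-inconsistent. -/
def HasITP2With (L' : FirstOrder.Language.{u, u}) (C : Type u) [L'.Structure C]
    {L : FirstOrder.Language.{u, u}} {M : Type u} [L.Structure M] {α β : Type} {k : ℕ}
    (φ : L.Formula (α ⊕ β)) (q : Fin k → C) : Prop :=
  ∃ a : ℕ → C → β → M,
    (∀ f : ℕ → C, Consistent (fun _ : ℕ => φ) fun i => a i (f i)) ∧
    (∀ i : ℕ, QInconsistent L' φ q (a i))

/-- `φ` has `I`-TP₂, for the index structure `C`. -/
def HasITP2 (L' : FirstOrder.Language.{u, u}) (C : Type u) [L'.Structure C]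
    {L : FirstOrder.Language.{u, u}} {M : Type u} [L.Structure M] {α β : Type}
    (φ : L.Formula (α ⊕ β)) : Prop :=
  ∃ (k : ℕ) (q : Fin k → C), HasITP2With L' C (M := M) φ q

/-- The classical tree property: a tree of parameters indexed by `ω^{<ω}` with consistent branches
and `k`-inconsistent siblings. -/
def HasTP {L : FirstOrder.Language.{u, u}} {M : Type u} [L.Structure M] {α β : Type}
    (φ : L.Formula (α ⊕ β)) : Prop :=
  ∃ (a : List ℕ → β → M) (k : ℕ), 0 < k ∧
    (∀ b : ℕ → ℕ, Consistent (fun _ : ℕ => φ) fun n => a (List.ofFn fun i : Fin n => b i)) ∧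
    (∀ (η : List ℕ) (t : Fin k → ℕ), Function.Injective t →
      ¬ Consistent (fun _ : Fin k => φ) fun j => a (η ++ [t j]))

/-- The classical tree property of the first kind (TP₁): a tree of parameters indexed by `ω^{<ω}`
in which all initial segments of nodes are consistent and any `k` pairwise incomparable nodes are
inconsistent. -/
def HasTP1 {L : FirstOrder.Language.{u, u}} {M : Type u} [L.Structure M] {α β : Type}
    (φ : L.Formula (α ⊕ β)) : Prop :=
  ∃ (a : List ℕ → β → M) (k : ℕ), 0 < k ∧
    (∀ η : List ℕ, Consistent (fun i : Fin (η.length + 1) => φ) fun i => a (η.take i)) ∧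
    (∀ t : Fin k → List ℕ, (∀ i j, i ≠ j → ¬ t i <+: t j) →
      ¬ Consistent (fun _ : Fin k => φ) fun j => a (t j))

/-- The conjunction `ψ (x; y₀, …, y_{c-1}) = ⋀_{i<c} φ (x, yᵢ)` of `c` instances of `φ` has TP₁;
the parameters of `ψ` are organized as `c`-tuples of `β`-tuples. -/
def ConjHasTP1 {L : FirstOrder.Language.{u, u}} {M : Type u} [L.Structure M] {α β : Type}
    (φ : L.Formula (α ⊕ β)) (c : ℕ) : Prop :=
  ∃ (a : List ℕ → Fin c → β → M) (k : ℕ), 0 < k ∧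
    (∀ η : List ℕ, Consistent (fun p : Fin (η.length + 1) × Fin c => φ)
      fun p => a (η.take p.1) p.2) ∧
    (∀ t : Fin k → List ℕ, (∀ i j, i ≠ j → ¬ t i <+: t j) →
      ¬ Consistent (fun _ : Fin k × Fin c => φ) fun p => a (t p.1) p.2)

/-- The structure, in the language of `κ`-colored linear orders, on the tree of nodes `C^{<ω}`:
nodes are compared in the lexicographic order of the tree, and each node (other than the root)
carries the color of its last entry. -/
def nodeStructure (κ C : Type u) [(colLang κ).Structure C] :
    (colLang κ).Structure (List C) where
  funMap := fun {n} f _ => PEmpty.elim f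
  RelMap := fun {n} =>
    match n with
    | 0 => fun r _ => PEmpty.elim r
    | 1 => fun c x => ∃ (η : List C) (i : C), x 0 = η ++ [i] ∧ HasColor κ c i
    | 2 => fun _ x => List.Lex (cLT κ) (x 0) (x 1)
    | (_ + 3) => fun r _ => PEmpty.elim r

/-- `φ` has c-TP₁ witnessed by the complete quantifier-free type of the tuple `q` from the colored
linear order `C`: there is a tree of parameters indexed by `C^{<ω}` in which all initial segments
of nodes are consistent, while any pairwise incomparable nodes whose quantifier-free type in the
language of `C` (nodes carrying the colors of their last entries, ordered lexicographically) is
`q` are inconsistent. -/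
def HasCTP1With (κ C : Type u) [(colLang κ).Structure C]
    {L : FirstOrder.Language.{u, u}} {M : Type u} [L.Structure M] {α β : Type} {k : ℕ}
    (φ : L.Formula (α ⊕ β)) (q : Fin k → C) : Prop :=
  ∃ a : List C → β → M,
    (∀ η : List C, Consistent (fun i : Fin (η.length + 1) => φ) fun i => a (η.take i)) ∧
    (∀ t : Fin k → List C, (∀ i j, i ≠ j → ¬ t i <+: t j) →
      (letI := nodeStructure κ C; qfTypeEq (colLang κ) q t) →
      ¬ Consistent (fun _ : Fin k => φ) fun j => a (t j))

/-- `φ` has c-TP₁, for the colored linear order `C`. -/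
def HasCTP1 (κ C : Type u) [(colLang κ).Structure C]
    {L : FirstOrder.Language.{u, u}} {M : Type u} [L.Structure M] {α β : Type}
    (φ : L.Formula (α ⊕ β)) : Prop :=
  ∃ (k : ℕ) (q : Fin k → C), HasCTP1With κ C (M := M) φ q

/-! ### Stability, IP, and order indiscernibles -/

/-- `φ (x, y)` is unstable (has the order property). -/
def HasOrderProperty {L : FirstOrder.Language.{u, u}} {M : Type u} [L.Structure M] {α β : Type}
    (φ : L.Formula (α ⊕ β)) : Prop :=
  ∃ (a : ℕ → α → M) (b : ℕ → β → M),
    ∀ i j : ℕ, Formula.Realize φ (Sum.elim (a i) (b j)) ↔ i < j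

/-- `(a i)_{i<ω}` is an indiscernible sequence of `γ`-tuples. -/
def OrderIndiscernible {L : FirstOrder.Language.{u, u}} {M : Type u} [L.Structure M] {γ : Type}
    (a : ℕ → γ → M) : Prop :=
  ∀ (n : ℕ) (t s : Fin n → ℕ), StrictMono t → StrictMono s →
    ∀ φ : L.Formula (Fin n × γ),
      (Formula.Realize φ fun p => a (t p.1) p.2) ↔ Formula.Realize φ fun p => a (s p.1) p.2

/-- `φ (x, y)` has the independence property: there is an indiscernible sequence `(a i)` such that
`{φ (x, aᵢ) : i even} ∪ {¬ φ (x, aᵢ) : i odd}` is consistent. -/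
def HasIP {L : FirstOrder.Language.{u, u}} {M : Type u} [L.Structure M] {α β : Type}
    (φ : L.Formula (α ⊕ β)) : Prop :=
  ∃ a : ℕ → β → M, OrderIndiscernible (L := L) a ∧
    ∃ E : ElemExtension L M,
      letI := E.str
      ∃ x : α → E.carrier, ∀ i : ℕ,
        (Even i → Formula.Realize φ (Sum.elim x fun j => E.emb.toFun (a i j))) ∧
        (¬ Even i → ¬ Formula.Realize φ (Sum.elim x fun j => E.emb.toFun (a i j)))

/-- The conjunction `ψ (x; y₀, …, y_{c-1}) = ⋀_{i<c} φ (x, yᵢ)` of `c` instances of `φ` has the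
independence property; the parameters of `ψ` are organized as `c`-tuples of `β`-tuples. -/
def ConjHasIP {L : FirstOrder.Language.{u, u}} {M : Type u} [L.Structure M] {α β : Type}
    (φ : L.Formula (α ⊕ β)) (c : ℕ) : Prop :=
  ∃ a : ℕ → Fin c → β → M, OrderIndiscernible (L := L) (fun i (p : Fin c × β) => a i p.1 p.2) ∧
    ∃ E : ElemExtension L M,
      letI := E.str
      ∃ x : α → E.carrier, ∀ i : ℕ,
        (Even i → ∀ m : Fin c, Formula.Realize φ (Sum.elim x fun j => E.emb.toFun (a i m j))) ∧
        (¬ Even i → ∃ m : Fin c, ¬ Formula.Realize φ (Sum.elim x fun j => E.emb.toFun (a i m j)))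

/-! ### Generalized dividing and local character -/

/-- `φ (x, c)` `I`-divides over the set `B`: there is an `I`-indexed family of tuples,
indiscernible over `B`, containing `c`, such that the corresponding family of instances of `φ`
is inconsistent. -/
def FormulaDividesOver (L' : FirstOrder.Language.{u, u}) (C : Type u) [L'.Structure C]
    {L : FirstOrder.Language.{u, u}} {M : Type u} [L.Structure M] {α β : Type}
    (φ : L.Formula (α ⊕ β)) (c : β → M) (B : Set M) : Prop :=
  ∃ (f : C → β → M) (j₀ : C), IndexedIndiscernibleOver (L := L) L' C B f ∧ f j₀ = c ∧
    ¬ Consistent (fun _ : C => φ) f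

/-- `(a i)` is a `q`-inconsistent `I`-dividing chain for `φ`: the instances `φ (x, a i)` are
jointly consistent, and each `φ (x, a i)` `I`-divides over the earlier elements of the chain,
witnessed by an indiscernible family that is `q`-inconsistent for the single fixed complete
quantifier-free type represented by the tuple `q`. -/
def QIncDividingChain (L' : FirstOrder.Language.{u, u}) (C : Type u) [L'.Structure C]
    {L : FirstOrder.Language.{u, u}} {M : Type u} [L.Structure M] {α β : Type}
    (φ : L.Formula (α ⊕ β)) {k : ℕ} (q : Fin k → C) {J : Type v} [LinearOrder J]
    (a : J → β → M) : Prop :=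
  Consistent (fun _ : J => φ) a ∧
  ∀ i : J, ∃ (f : C → β → M) (j₀ : C),
    IndexedIndiscernibleOver (L := L) L' C {m : M | ∃ j x, j < i ∧ m = a j x} f ∧
    f j₀ = a i ∧ QInconsistent L' φ q f ∧ ¬ Consistent (fun _ : C => φ) f

/-- `p` is a complete type over `A` in the variables `α`, presented as a set of formulas paired
with their parameter tuples: all parameters come from `A`, `p` is finitely satisfiable, and `p`
decides every formula with parameters in `A`. -/
def IsCompleteTypeOver (L : FirstOrder.Language.{u, u}) (M : Type u) [L.Structure M] (A : Set M)
    (α : Type) (p : Set (Σ k : ℕ, L.Formula (α ⊕ Fin k) × (Fin k → M))) : Prop :=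
  (∀ ψ ∈ p, ∀ j, ψ.2.2 j ∈ A) ∧
  (∀ S ⊆ p, S.Finite →
    ∃ E : ElemExtension L M,
      letI := E.str
      ∃ x : α → E.carrier, ∀ ψ ∈ S,
        Formula.Realize ψ.2.1 (Sum.elim x fun j => E.emb.toFun (ψ.2.2 j))) ∧
  (∀ (k : ℕ) (φ : L.Formula (α ⊕ Fin k)) (c : Fin k → M), (∀ j, c j ∈ A) →
    (⟨k, φ, c⟩ ∈ p ∨ ⟨k, BoundedFormula.not φ, c⟩ ∈ p))

/-- The type `p` `I`-divides over the set `B` if some formula in it does. -/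
def TypeDividesOver (L' : FirstOrder.Language.{u, u}) (C : Type u) [L'.Structure C]
    {L : FirstOrder.Language.{u, u}} {M : Type u} [L.Structure M] {α : Type}
    (p : Set (Σ k : ℕ, L.Formula (α ⊕ Fin k) × (Fin k → M))) (B : Set M) : Prop :=
  ∃ ψ ∈ p, FormulaDividesOver L' C ψ.2.1 ψ.2.2 B

/-- Equality of complete quantifier-free types is an equivalence relation on `n`-tuples. -/
def qfSetoid (L' : FirstOrder.Language.{u, u}) (C : Type u) [L'.Structure C] (n : ℕ) :
    Setoid (Fin n → C) :=
  ⟨fun t s => qfTypeEq L' t s,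
    fun _ _ _ => Iff.rfl,
    fun h φ hφ => (h φ hφ).symm,
    fun h₁ h₂ φ hφ => (h₁ φ hφ).trans (h₂ φ hφ)⟩

/-- The number of complete quantifier-free types of `C` in finitely many variables. -/
def numQfTypes (L' : FirstOrder.Language.{u, u}) (C : Type u) [L'.Structure C] : Cardinal.{u} :=
  #(Σ n : ℕ, Quotient (qfSetoid L' C n))

/-- `I`-dividing has local character (for the complete theory of `M`): every complete type over
any set `A` fails to `I`-divide over some subset of `A` of size at most `|T| + κ`, where `κ` is
the number of complete quantifier-free types of the index structure in finitely many variables. -/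
def LocalChar (L : FirstOrder.Language.{u, u}) (M : Type u) [L.Structure M]
    (L' : FirstOrder.Language.{u, u}) (C : Type u) [L'.Structure C] : Prop :=
  ∀ (α : Type) (A : Set M) (p : Set (Σ k : ℕ, L.Formula (α ⊕ Fin k) × (Fin k → M))),
    IsCompleteTypeOver L M A α p →
    ∃ B : Set M, B ⊆ A ∧ #B ≤ Language.card L + ℵ₀ + numQfTypes L' C ∧
      ¬ TypeDividesOver L' C p B

/-! ### Monster models -/

/-- `M` is `κ̄`-saturated: every finitely satisfiable family of formulas whose parameters form a
set of size `< κ̄` is realized in `M`. -/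
def Saturated (L : FirstOrder.Language.{u, u}) (M : Type u) [L.Structure M]
    (κbar : Cardinal.{u}) : Prop :=
  ∀ (α : Type) (ι : Type u) (ks : ι → ℕ) (φs : ∀ i, L.Formula (α ⊕ Fin (ks i)))
    (as : ∀ i, Fin (ks i) → M),
    #(⋃ i, Set.range (as i)) < κbar →
    (∀ s : Set ι, s.Finite → ∃ x : α → M, ∀ i ∈ s, Formula.Realize (φs i) (Sum.elim x (as i))) →
    ∃ x : α → M, ∀ i, Formula.Realize (φs i) (Sum.elim x (as i))

/-- `M` is a monster model (relative to the bound `κ̄`): it is infinite, `κ̄`-saturated, and `κ̄`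
is an uncountable strong limit. -/
def IsMonster (L : FirstOrder.Language.{u, u}) (M : Type u) [L.Structure M]
    (κbar : Cardinal.{u}) : Prop :=
  Infinite M ∧ Saturated L M κbar ∧ ℵ₀ < κbar ∧
    ∀ μ : Cardinal.{u}, μ < κbar → 2 ^ μ < κbar

/-! ### Maps between colored linear order languages -/

/-- Two tuples in structures of two different languages related by a language morphism have
corresponding quantifier-free types. -/
def qfTypeEqAlong {L₁ L₂ : FirstOrder.Language.{u, u}} (Φ : L₁ →ᴸ L₂) {A B : Type u}
    [L₁.Structure A] [L₂.Structure B] {n : ℕ} (t : Fin n → A) (s : Fin n → B) : Prop :=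
  ∀ φ : L₁.Formula (Fin n), BoundedFormula.IsQF φ →
    (Formula.Realize φ t ↔ Formula.Realize (LHom.onFormula Φ φ) s)

/-- The morphism of colored linear order languages induced by a map of colors. -/
def colMap {σ τ : Type u} (i : σ → τ) : colLang σ →ᴸ colLang τ where
  onFunction := fun {_} f => PEmpty.elim f
  onRelation := fun {n} =>
    match n with
    | 0 => fun r => PEmpty.elim r
    | 1 => fun c => i c
    | 2 => fun r => r
    | (_ + 3) => fun r => PEmpty.elim r

/-! ### Generalized tree and array index structures -/

/-- The relational version `L'ᵣ` of a language `L'`: every `n`-ary function symbol is replaced by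
an `(n+1)`-ary relation symbol. -/
def relationalize (L' : FirstOrder.Language.{u, u}) : FirstOrder.Language.{u, u} where
  Functions := fun _ => PEmpty
  Relations := fun n =>
    match n with
    | 0 => L'.Relations 0
    | (m + 1) => L'.Relations (m + 1) ⊕ L'.Functions m

/-- Interpret the relationalized language `L'ᵣ` on a type `A` that contains disjoint copies
`emb b : I → A` of the `L'`-structure `I`: relations (and graphs of functions) hold only within a
single copy, where they are computed in `I`. -/
def relationalizeStructure (L' : FirstOrder.Language.{u, u}) {I A B : Type u} [L'.Structure I]
    (emb : B → I → A) : (relationalize L').Structure A where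
  funMap := fun {_} f _ => PEmpty.elim f
  RelMap := fun {n} =>
    match n with
    | 0 => fun r _ => Structure.RelMap (L := L') (M := I) r fun j : Fin 0 => j.elim0
    | (m + 1) => fun r x =>
      match r with
      | Sum.inl r => ∃ (b : B) (ids : Fin (m + 1) → I),
          (∀ j, x j = emb b (ids j)) ∧ Structure.RelMap (M := I) r ids
      | Sum.inr f => ∃ (b : B) (ids : Fin (m + 1) → I),
          (∀ j, x j = emb b (ids j)) ∧
            Structure.funMap (M := I) f (fun j : Fin m => ids j.castSucc) = ids (Fin.last m)

/-- The base language of trees: the tree partial order `⊴`, the lexicographic order `<ₗₑₓ`, and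
the binary meet function `∧`. -/
def treeBase : FirstOrder.Language.{u, u} where
  Functions := fun n =>
    match n with
    | 2 => PUnit.{u + 1}
    | _ => PEmpty.{u + 1}
  Relations := fun n =>
    match n with
    | 2 => (PUnit.{u + 1} ⊕ PUnit.{u + 1} : Type u)
    | _ => PEmpty.{u + 1}

/-- The longest common prefix (meet) of two finite sequences. -/
noncomputable def lcp {I : Type u} : List I → List I → List I
  | a :: as, b :: bs => if Classical.propDecidable (a = b) |>.decide then a :: lcp as bs else []
  | _, _ => []

/-- The base tree structure on `I^{<ω}`: `⊴` is the prefix (tree) order, `<ₗₑₓ` the lexicographic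
order induced by the order `r` on `I`, and `∧` the longest common prefix. -/
noncomputable def treeBaseStructure (I : Type u) (r : I → I → Prop) :
    treeBase.Structure (List I) where
  funMap := fun {n} f x =>
    match n, f with
    | 0, f => PEmpty.elim f
    | 1, f => PEmpty.elim f
    | 2, _ => lcp (x 0) (x 1)
    | (_ + 3), f => PEmpty.elim f
  RelMap := fun {n} R x =>
    match n, R with
    | 0, R => PEmpty.elim R
    | 1, R => PEmpty.elim R
    | 2, Sum.inl _ => x 0 <+: x 1
    | 2, Sum.inr _ => List.Lex r (x 0) (x 1)
    | (_ + 3), R => PEmpty.elim R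

/-- The language of level predicates `P_α` for `α < ω`. -/
def levelLang : FirstOrder.Language.{u, u} where
  Functions := fun _ => PEmpty
  Relations := fun n =>
    match n with
    | 1 => ULift ℕ
    | _ => PEmpty

/-- The interpretation of the level predicates on a tree `I^{<ω}`: `P_α` holds of exactly the
nodes of length `α`. -/
def levelStructure (I : Type u) : levelLang.Structure (List I) where
  funMap := fun {_} f _ => PEmpty.elim f
  RelMap := fun {n} R x =>
    match n, R with
    | 1, m => (x 0).length = m.down

/-- The language `L_{0,I}` for trees over the index structure `I`. -/
def treeLang0 (L' : FirstOrder.Language.{u, u}) : FirstOrder.Language.{u, u} :=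
  treeBase.sum (relationalize L')

/-- The language `L_{s,ω,I}` for trees of height `ω` over the index structure `I`. -/
def treeLangS (L' : FirstOrder.Language.{u, u}) : FirstOrder.Language.{u, u} :=
  (treeLang0 L').sum levelLang

/-- The `L_{0,I}`-structure on the tree `I^{<ω}`, where the set of immediate successors of any
node is a copy of `I`. -/
noncomputable def treeStructure0 (L' : FirstOrder.Language.{u, u}) (I : Type u) [L'.Structure I]
    (lt : L'.Relations 2) : (treeLang0 L').Structure (List I) :=
  letI := treeBaseStructure I fun a b => Structure.RelMap lt ![a, b]
  letI := relationalizeStructure L' fun (η : List I) (i : I) => η ++ [i]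
  inferInstanceAs ((treeBase.sum (relationalize L')).Structure (List I))

/-- The `L_{s,ω,I}`-structure on the tree `I^{<ω}`. -/
noncomputable def treeStructureS (L' : FirstOrder.Language.{u, u}) (I : Type u) [L'.Structure I]
    (lt : L'.Relations 2) : (treeLangS L').Structure (List I) :=
  letI := treeStructure0 L' I lt
  letI := levelStructure I
  inferInstanceAs (((treeLang0 L').sum levelLang).Structure (List I))

/-- The base language of arrays: a linear order and an equivalence relation. -/
def arrayBase : FirstOrder.Language.{u, u} where
  Functions := fun _ => PEmpty
  Relations := fun n =>
    match n with
    | 2 => (PUnit.{u + 1} ⊕ PUnit.{u + 1} : Type u)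
    | _ => PEmpty.{u + 1}

/-- The convexly ordered equivalence relation on `K × I` whose classes are the rows
`{α} × I`. -/
def arrayBaseStructure (K I : Type u) [LinearOrder K] (r : I → I → Prop) :
    arrayBase.Structure (K × I) where
  funMap := fun {_} f _ => PEmpty.elim f
  RelMap := fun {n} R x =>
    match n, R with
    | 0, R => PEmpty.elim R
    | 1, R => PEmpty.elim R
    | 2, Sum.inl _ => (x 0).1 < (x 1).1 ∨ ((x 0).1 = (x 1).1 ∧ r (x 0).2 (x 1).2)
    | 2, Sum.inr _ => (x 0).1 = (x 1).1
    | (_ + 3), R => PEmpty.elim R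

/-- The language of `I`-arrays: a convexly ordered equivalence relation together with the
relational version of the language of `I`. -/
def arrayLang (L' : FirstOrder.Language.{u, u}) : FirstOrder.Language.{u, u} :=
  arrayBase.sum (relationalize L')

/-- The structure of a convexly ordered equivalence relation on `K × I` whose classes are the
copies `{α} × I` of `I` (with functions of `I` replaced by their graphs on each copy). -/
def arrayStructure (L' : FirstOrder.Language.{u, u}) (K I : Type u) [LinearOrder K]
    [L'.Structure I] (lt : L'.Relations 2) : (arrayLang L').Structure (K × I) :=
  letI := arrayBaseStructure K I fun a b => Structure.RelMap lt ![a, b]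
  letI := relationalizeStructure L' fun (k : K) (i : I) => (k, i)
  inferInstanceAs ((arrayBase.sum (relationalize L')).Structure (K × I))

/-- A `K × I`-array of tuples is mutually `I`-indiscernible: each row is an `I`-indexed
indiscernible family over the entries of all the other rows. -/
def MutuallyIndiscernible (L' : FirstOrder.Language.{u, u}) (I : Type u) [L'.Structure I]
    {L : FirstOrder.Language.{u, u}} {M : Type u} [L.Structure M] {K : Type u} {β : Type}
    (a : K → I → β → M) : Prop :=
  ∀ i : K, IndexedIndiscernibleOver (L := L) L' I
    {m : M | ∃ k j x, k ≠ i ∧ m = a k j x} (a i)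

/-- A `K × I`-array of tuples is strongly `I`-indiscernible: it is mutually `I`-indiscernible and
the sequence of its rows is an indiscernible sequence. -/
def StronglyIndiscernibleArray (L' : FirstOrder.Language.{u, u}) (I : Type u) [L'.Structure I]
    {L : FirstOrder.Language.{u, u}} {M : Type u} [L.Structure M] {K : Type u} [LinearOrder K]
    {β : Type} (a : K → I → β → M) : Prop :=
  MutuallyIndiscernible (L := L) L' I a ∧
  ∀ (n : ℕ) (t s : Fin n → K), StrictMono t → StrictMono s →
    ∀ φ : L.Formula (Fin n × (I × β)),
      ((Formula.Realize φ fun p => a (t p.1) p.2.1 p.2.2) ↔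
        Formula.Realize φ fun p => a (s p.1) p.2.1 p.2.2)


/-! ### Auxiliary lemmas for the proof -/

section Aux

variable {L : FirstOrder.Language.{u, u}}

/-- Only finitely many of the variables of a formula matter. -/
theorem fin_restrict {P Q : Type*} (χ : L.Formula (P ⊕ Q)) :
    ∃ (k : ℕ) (g : Fin k → Q) (χ' : L.Formula (P ⊕ Fin k)), Function.Injective g ∧
      ∀ (N : Type u) [L.Structure N] (p : P → N) (r : Q → N),
        χ'.Realize (Sum.elim p (r ∘ g)) ↔ χ.Realize (Sum.elim p r) := by
  classical
  let T : Finset Q := χ.freeVarFinset.preimage Sum.inr Sum.inr_injective.injOn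
  let ρ : χ.freeVarFinset → P ⊕ Fin T.card := fun a =>
    match a with
    | ⟨Sum.inl p, _⟩ => Sum.inl p
    | ⟨Sum.inr r, h⟩ => Sum.inr (T.equivFin ⟨r, by simpa [T] using h⟩)
  refine ⟨T.card, fun i => (T.equivFin.symm i : Q), χ.restrictFreeVar ρ, ?_, ?_⟩
  · exact Subtype.val_injective.comp T.equivFin.symm.injective
  · intro N _ p r
    refine BoundedFormula.realize_restrictFreeVar _ ?_
    rintro ⟨a | a, ha⟩
    · rfl
    · simp [ρ]

/-- Existential projection along possibly infinitely many variables. -/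
theorem exists_proj {P Q : Type*} (χ : L.Formula (P ⊕ Q)) :
    ∃ χ' : L.Formula P, ∀ (N : Type u) [L.Structure N] [Nonempty N] (p : P → N),
      χ'.Realize p ↔ ∃ r : Q → N, χ.Realize (Sum.elim p r) := by
  classical
  obtain ⟨k, g, χ', hg, h⟩ := fin_restrict χ
  refine ⟨χ'.iExs (Fin k), fun N _ _ p => ?_⟩
  rw [Formula.realize_iExs]
  constructor
  · rintro ⟨i, hi⟩
    refine ⟨Function.extend g i fun _ => Classical.arbitrary N, ?_⟩
    rw [← h]
    rwa [Function.extend_comp hg]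
  · rintro ⟨r, hr⟩
    exact ⟨r ∘ g, (h N p r).2 hr⟩

/-- Bundling an elementary extension. -/
def mkExt {M : Type u} [L.Structure M] (N : Type u) [S : L.Structure N] (e : M ↪ₑ[L] N) :
    ElemExtension L M := ⟨N, S, e⟩

theorem consistent_formula {α β : Type} (φ : L.Formula (α ⊕ β)) (k : ℕ) :
    ∃ χ : L.Formula (Fin k × β), ∀ (N : Type u) [L.Structure N] [Nonempty N]
      (a : Fin k → β → N),
      (χ.Realize fun p => a p.1 p.2) ↔ Consistent (fun _ : Fin k => φ) a := by
  obtain ⟨χ, hχ⟩ := exists_proj (L := L) (P := Fin k × β) (Q := α)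
    (Formula.iInf fun l : Fin k => φ.relabel
      (Sum.elim (fun x => Sum.inr x) fun y => Sum.inl (l, y) : α ⊕ β → (Fin k × β) ⊕ α))
  have key : ∀ (N : Type u) [L.Structure N] [Nonempty N] (a : Fin k → β → N),
      (χ.Realize fun p => a p.1 p.2) ↔ ∃ x : α → N, ∀ l, φ.Realize (Sum.elim x (a l)) := by
    intro N _ _ a
    rw [hχ]
    refine exists_congr fun x => ?_
    rw [Formula.realize_iInf]
    refine forall_congr' fun l => ?_
    rw [Formula.realize_relabel]
    apply iff_of_eq
    congr 1
    ext z
    rcases z with z | z <;> rfl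
  refine ⟨χ, fun N _ _ a => ?_⟩
  constructor
  · intro h
    obtain ⟨x, hx⟩ := (key N a).1 h
    exact ⟨mkExt N (ElementaryEmbedding.refl L N), x, hx⟩
  · rintro ⟨⟨E, S, e⟩, x, hx⟩
    have : Nonempty E := ⟨e (Classical.arbitrary N)⟩
    rw [← e.map_formula]
    exact (key E (fun l y => e (a l y))).2 ⟨x, hx⟩

theorem qf_comp {L' : FirstOrder.Language.{u, u}} {C : Type u} [L'.Structure C] {n m : ℕ}
    {t s : Fin n → C} (h : qfTypeEq L' t s) (g : Fin m → Fin n) :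
    qfTypeEq L' (t ∘ g) (s ∘ g) := by
  intro ψ hψ
  have := h (ψ.relabel g) (hψ.relabel _)
  rwa [Formula.realize_relabel, Formula.realize_relabel] at this

theorem qInconsistent_not_consistent {L' : FirstOrder.Language.{u, u}} {C : Type u}
    [L'.Structure C] {M : Type u} [L.Structure M] {α β : Type} {k : ℕ}
    {φ : L.Formula (α ⊕ β)} {q : Fin k → C} {f : C → β → M} (h : QInconsistent L' φ q f) :
    ¬ Consistent (fun _ : C => φ) f := by
  rintro ⟨E, x, hx⟩
  exact h q (fun _ _ => Iff.rfl) ⟨E, x, fun l => hx (q l)⟩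

theorem indisc_formula {L' : FirstOrder.Language.{u, u}} {C : Type u}
    [L'.Structure C] {M : Type u} [L.Structure M] {β : Type} {A : Set M} {f : C → β → M}
    (h : IndexedIndiscernibleOver (L := L) L' C A f) {n : ℕ} {t s : Fin n → C}
    (hts : qfTypeEq L' t s) (θ : L.Formula (Fin n × β ⊕ A)) :
    θ.Realize (Sum.elim (fun p => f (t p.1) p.2) fun a : A => (a : M)) ↔
      θ.Realize (Sum.elim (fun p => f (s p.1) p.2) fun a : A => (a : M)) := by
  obtain ⟨k, g, theta, -, hθ⟩ := fin_restrict θ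
  rw [← hθ, ← hθ]
  exact h n k t s _ (fun j => (g j).2) hts theta

/-- The witnessing families `f` and `f'` have the same type over `A`. -/
def SameType {M N : Type u} [L.Structure M] [L.Structure N] (V : Type u) {P : Type u}
    (a : P → M) (f : V → M) (a' : P → N) (f' : V → N) : Prop :=
  ∀ ψ : L.Formula (P ⊕ V), ψ.Realize (Sum.elim a f) → ψ.Realize (Sum.elim a' f')

theorem SameType.iff {M N : Type u} [L.Structure M] [L.Structure N] {V P : Type u}
    {a : P → M} {f : V → M} {a' : P → N} {f' : V → N}
    (h : SameType (L := L) V a f a' f') (ψ : L.Formula (P ⊕ V)) :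
    ψ.Realize (Sum.elim a f) ↔ ψ.Realize (Sum.elim a' f') := by
  refine ⟨h ψ, fun h' => ?_⟩
  by_contra hc
  have := h ψ.not (by rwa [Formula.realize_not])
  rw [Formula.realize_not] at this
  exact this h'

theorem SameType.indisc {L' : FirstOrder.Language.{u, u}} {C : Type u}
    [L'.Structure C] {M N : Type u} [L.Structure M] [L.Structure N] {β : Type} {A : Set M}
    {f : C → β → M} {f' : C → β → N} {e : A → N}
    (h : SameType (L := L) (C × β) (fun a : A => (a : M)) (fun p => f p.1 p.2)
      e (fun p => f' p.1 p.2))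
    (hf : IndexedIndiscernibleOver (L := L) L' C A f) :
    IndexedIndiscernibleOver (L := L) L' C (Set.range e) f' := by
  intro n k t s c hc hts ψ
  choose c' hc' using hc
  have key : ∀ t : Fin n → C,
      ψ.Realize (Sum.elim (fun p => f (t p.1) p.2) (fun j => (c' j : M))) ↔
      ψ.Realize (Sum.elim (fun p => f' (t p.1) p.2) c) := by
    intro t
    have := h.iff (ψ.relabel (Sum.elim (fun p => Sum.inr (t p.1, p.2)) fun j => Sum.inl (c' j)))
    rw [Formula.realize_relabel, Formula.realize_relabel] at this
    convert this using 2
    · ext z; rcases z with z | z <;> rfl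
    · ext z; rcases z with z | z
      · rfl
      · exact (hc' z).symm
  rw [← key, ← key]
  exact hf n k t s _ (fun j => (c' j).2) hts ψ

theorem SameType.qInc {L' : FirstOrder.Language.{u, u}} {C : Type u}
    [L'.Structure C] {M N : Type u} [L.Structure M] [L.Structure N] [Nonempty M] [Nonempty N]
    {α β : Type} {P : Type u} {a : P → M}
    {f : C → β → M} {f' : C → β → N} {e : P → N}
    (h : SameType (L := L) (C × β) a (fun p => f p.1 p.2)
      e (fun p => f' p.1 p.2)) {k : ℕ} {φ : L.Formula (α ⊕ β)} {q : Fin k → C}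
    (hf : QInconsistent L' φ q f) : QInconsistent L' φ q f' := by
  intro t ht hc
  obtain ⟨χ, hχ⟩ := consistent_formula φ k
  refine hf t ht ?_
  rw [← hχ] at hc ⊢
  have := h.iff (χ.relabel (fun p => Sum.inr (t p.1, p.2)))
  rw [Formula.realize_relabel, Formula.realize_relabel] at this
  exact this.2 hc

/-- Ultrapowers as elementary extensions. -/
def ultraEmb (M : Type u) [L.Structure M] [Nonempty M] {D : Type u} (U : Ultrafilter D) :
    M ↪ₑ[L] (U : Filter D).Product (fun _ => M) where
  toFun m := ((fun _ => m : ∀ _ : D, M) : (U : Filter D).Product (fun _ => M))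
  map_formula' := by
    intro n φ x
    have := Ultraproduct.realize_formula_cast (M := fun _ : D => M) (u := U) φ (fun i _ => x i)
    refine Iff.trans this ?_
    simp

/-- Simultaneous compactness. -/
theorem multi_compact (M : Type u) [L.Structure M] [Nonempty M] {K : Type} {V : Type u}
    (Γ : K → Set (L.Formula (M ⊕ V)))
    (h : ∀ i, ∀ s : Finset (Γ i), ∃ v : V → M, ∀ ψ ∈ s, ψ.1.Realize (Sum.elim id v)) :
    ∃ (N : Type u) (_ : L.Structure N) (e : M ↪ₑ[L] N) (v : K → V → N),
      ∀ i, ∀ ψ ∈ Γ i, ψ.Realize (Sum.elim e (v i)) := by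
  classical
  choose v hv using h
  let D : Type u := ∀ i, Finset (Γ i)
  let U : Ultrafilter D := Ultrafilter.of Filter.atTop
  refine ⟨(U : Filter D).Product (fun _ => M), inferInstance, ultraEmb M U,
    fun i x => ((fun d => v i (d i) x : ∀ _ : D, M) : (U : Filter D).Product (fun _ => M)), ?_⟩
  intro i ψ hψ
  have := Ultraproduct.realize_formula_cast (M := fun _ : D => M) (u := U) ψ
    (Sum.elim (fun m _ => m) fun x d => v i (d i) x)
  have h2 : ∀ᶠ d : D in (U : Filter D), ψ.Realize fun z =>
      (Sum.elim (fun m _ => m) (fun x d => v i (d i) x) : M ⊕ V → D → M) z d := by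
    refine Filter.Eventually.filter_mono (Ultrafilter.of_le _) (Filter.eventually_atTop.2
      ⟨fun j => if hj : j = i then {⟨ψ, hj ▸ hψ⟩} else ∅, fun d hd => ?_⟩)
    have hm : (⟨ψ, hψ⟩ : Γ i) ∈ d i := by
      have := hd i
      simp only [dite_true] at this
      exact this (Finset.mem_singleton_self _)
    have := hv i (d i) _ hm
    convert this using 1
    ext z; rcases z with z | z <;> rfl
  have h3 := this.2 h2
  refine (iff_of_eq (congrArg ψ.Realize ?_)).mp h3
  funext z; rcases z with z | z <;> rfl

theorem shift {M : Type u} [L.Structure M] [Nonempty M] {C : Type u} {β : Type} (c₀ : C)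
    (a : ℕ → β → M) (A : ℕ → Set M) (f : ℕ → C → β → M)
    (hty : ∀ i, ∀ θ : L.Formula (A i ⊕ β),
      θ.Realize (Sum.elim (fun m : A i => (m : M)) (f i c₀)) →
      θ.Realize (Sum.elim (fun m : A i => (m : M)) (a i))) :
    ∃ (N : Type u) (_ : L.Structure N) (e : M ↪ₑ[L] N) (f' : ℕ → C → β → N),
      (∀ i x, f' i c₀ x = e (a i x)) ∧
      ∀ i, SameType (L := L) (C × β) (fun m : A i => (m : M)) (fun p => f i p.1 p.2)
        (fun m : A i => e m) (fun p => f' i p.1 p.2) := by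
  classical
  let ρ : ∀ i, A i ⊕ (C × β) → M ⊕ (C × β) := fun i =>
    Sum.elim (fun m => Sum.inl (m : M))
      fun p => if p.1 = c₀ then Sum.inl (a i p.2) else Sum.inr p
  let Γ : ℕ → Set (L.Formula (M ⊕ (C × β))) := fun i =>
    {ψ | ∃ ψ₀ : L.Formula (A i ⊕ (C × β)),
      ψ₀.Realize (Sum.elim (fun m : A i => (m : M)) fun p => f i p.1 p.2) ∧
      ψ = ψ₀.relabel (ρ i)}
  obtain ⟨N, S, e, v, hv⟩ := multi_compact M Γ (by
    intro i s
    choose g hg1 hg2 using fun ψ : Γ i => ψ.2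
    let χ : L.Formula (A i ⊕ (C × β)) := Formula.iInf fun ψ : s => g ψ.1
    obtain ⟨χ', hχ'⟩ := exists_proj (L := L) (P := A i ⊕ β) (Q := C × β)
      (χ.relabel (Sum.elim (fun m => Sum.inl (Sum.inl m))
        fun p => if p.1 = c₀ then Sum.inl (Sum.inr p.2) else Sum.inr p))
    have h1 : χ'.Realize (Sum.elim (fun m : A i => (m : M)) (f i c₀)) := by
      rw [hχ']
      refine ⟨fun p => f i p.1 p.2, ?_⟩
      rw [Formula.realize_relabel, Formula.realize_iInf]
      intro ψ
      refine (iff_of_eq (congrArg (g ψ.1).Realize ?_)).mp (hg1 ψ.1)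
      funext z
      rcases z with z | ⟨c, y⟩
      · rfl
      · by_cases hc : c = c₀
        · subst hc; simp
        · simp [hc]
    have h2 := hty i χ' h1
    rw [hχ'] at h2
    obtain ⟨r, hr⟩ := h2
    rw [Formula.realize_relabel, Formula.realize_iInf] at hr
    refine ⟨r, fun ψ hψ => ?_⟩
    rw [hg2 ψ, Formula.realize_relabel]
    refine (iff_of_eq (congrArg (g ψ).Realize ?_)).mp (hr ⟨ψ, hψ⟩)
    funext z
    rcases z with z | ⟨c, y⟩
    · rfl
    · by_cases hc : c = c₀
      · subst hc; simp [ρ]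
      · simp [hc, ρ])
  refine ⟨N, S, e, fun i c y => if c = c₀ then e (a i y) else v i (c, y), ?_, ?_⟩
  · intro i y; simp
  · intro i ψ hψ
    have := hv i _ ⟨ψ, hψ, rfl⟩
    rw [Formula.realize_relabel] at this
    refine (iff_of_eq (congrArg ψ.Realize ?_)).mp this
    funext z
    rcases z with z | ⟨c, y⟩
    · rfl
    · by_cases hc : c = c₀
      · subst hc; simp [ρ]
      · simp [hc, ρ]

theorem consistent_of_realize {M : Type u} [L.Structure M] {α β : Type} {ι : Type v}
    {φ : L.Formula (α ⊕ β)} {a : ι → β → M} (x : α → M)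
    (hx : ∀ i, φ.Realize (Sum.elim x (a i))) : Consistent (fun _ : ι => φ) a :=
  ⟨mkExt M (ElementaryEmbedding.refl L M), x, hx⟩

theorem stretch {L' : FirstOrder.Language.{u, u}} {C : Type u}
    [L'.Structure C] {M : Type u} [L.Structure M] [Nonempty M] {α β : Type}
    {φ : L.Formula (α ⊕ β)} {k : ℕ} {q : Fin k → C} (c₀ : C) (x : α → M) (a : ℕ → β → M)
    (f : ℕ → C → β → M) (hx : ∀ i, φ.Realize (Sum.elim x (a i)))
    (hf : ∀ i, f i c₀ = a i)
    (hind : ∀ i, IndexedIndiscernibleOver (L := L) L' C {m : M | ∃ j x, j < i ∧ m = a j x} (f i))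
    (hq : ∀ i, QInconsistent L' φ q (f i)) (J : Type u) [LinearOrder J] :
    ∃ (N : Type u) (_ : L.Structure N) (_ : M ↪ₑ[L] N) (b : J → β → N),
      QIncDividingChain L' C φ q b := by
  classical
  let U : Ultrafilter (Finset J) := Ultrafilter.of Filter.atTop
  let N := (U : Filter (Finset J)).Product (fun _ => M)
  let r : Finset J → J → ℕ := fun F j => (F.filter (· < j)).card
  have hr : ∀ F j i, j ∈ F → j < i → r F j < r F i := by
    intro F j i hj hji
    refine Finset.card_lt_card ?_
    refine Finset.ssubset_iff_of_subset ?_ |>.2 ⟨j, ?_, ?_⟩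
    · intro z hz
      simp only [Finset.mem_filter] at hz ⊢
      exact ⟨hz.1, hz.2.trans hji⟩
    · simp [hj, hji]
    · simp
  let cl : (Finset J → M) → N := fun g => ((g : ∀ _ : Finset J, M) : N)
  have los : ∀ {γ : Type} (ψ : L.Formula γ) (g : γ → Finset J → M),
      ψ.Realize (fun z => cl (g z)) ↔ ∀ᶠ F in (U : Filter (Finset J)), ψ.Realize fun z => g z F :=
    fun ψ g => Ultraproduct.realize_formula_cast (M := fun _ => M) (u := U) ψ g
  have : Nonempty N := ⟨cl fun _ => Classical.arbitrary M⟩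
  let b : J → β → N := fun j y => cl fun F => a (r F j) y
  let f' : J → C → β → N := fun j c y => cl fun F => f (r F j) c y
  refine ⟨N, inferInstance, ultraEmb M U, b, ?_, ?_⟩
  · refine consistent_of_realize (fun z => cl fun _ => x z) fun j => ?_
    have := (los φ (Sum.elim (fun z _ => x z) fun y F => a (r F j) y)).2
      (Filter.Eventually.of_forall fun F => by
        refine (iff_of_eq (congrArg φ.Realize ?_)).mp (hx (r F j))
        funext z; rcases z with z | z <;> rfl)
    refine (iff_of_eq (congrArg φ.Realize ?_)).mp this
    funext z; rcases z with z | z <;> rfl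
  · intro i
    have hqi : QInconsistent L' φ q (f' i) := by
      intro t ht hc
      obtain ⟨χ, hχ⟩ := consistent_formula φ k
      rw [← hχ] at hc
      have h2 := (los χ (fun p F => f (r F i) (t p.1) p.2)).1 hc
      obtain ⟨F, hF⟩ := h2.exists
      exact hq (r F i) t ht ((hχ M fun l => f (r F i) (t l)).1 hF)
    refine ⟨f' i, c₀, ?_, ?_, hqi, qInconsistent_not_consistent hqi⟩
    · intro n l t s c hc hts ψ
      choose j y hj hcj using hc
      have key : ∀ t : Fin n → C,
          ψ.Realize (Sum.elim (fun p => f' i (t p.1) p.2) c) ↔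
          ∀ᶠ F in (U : Filter (Finset J)), ψ.Realize
            (Sum.elim (fun p => f (r F i) (t p.1) p.2) fun d => a (r F (j d)) (y d)) := by
        intro t
        have := los ψ (Sum.elim (fun p F => f (r F i) (t p.1) p.2) fun d F => a (r F (j d)) (y d))
        refine Iff.trans (iff_of_eq (congrArg ψ.Realize ?_)) (this.trans (Filter.eventually_congr
          (Filter.Eventually.of_forall fun F => iff_of_eq (congrArg ψ.Realize ?_))))
        · funext z; rcases z with z | z
          · rfl
          · exact hcj z
        · funext z; rcases z with z | z <;> rfl
      rw [key, key]
      refine Filter.eventually_congr (Filter.Eventually.filter_mono (Ultrafilter.of_le _)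
        (Filter.eventually_atTop.2 ⟨Finset.univ.image j, fun F hF => ?_⟩))
      refine hind (r F i) n l t s _ (fun d => ?_) hts ψ
      exact ⟨r F (j d), y d, hr F _ _ (hF (by simp)) (hj d), rfl⟩
    · funext y
      exact congrArg cl (funext fun F => congrFun (hf _) y)

theorem constCase {L' : FirstOrder.Language.{u, u}} {C : Type u}
    [L'.Structure C] {M : Type u} [L.Structure M] {α β : Type}
    {φ : L.Formula (α ⊕ β)} {k : ℕ} {q : Fin k → C} (b : β → M)
    (hb : Consistent (fun _ : Unit => φ) fun _ => b) (A : Set M) (hA : ∀ y, b y ∈ A)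
    (f : C → β → M) (c₀ : C) (hc₀ : ∀ m, ¬ qfTypeEq L' (fun _ : Fin 1 => c₀) fun _ => q m)
    (hind : IndexedIndiscernibleOver (L := L) L' C A f)
    (hq : QInconsistent L' φ q f) (J : Type u) [LinearOrder J] :
    QIncDividingChain L' C φ q (fun _ : J => b) := by
  classical
  obtain ⟨E, x, hx⟩ := hb
  refine ⟨⟨E, x, fun _ => hx ()⟩, fun i => ?_⟩
  let D : C → Prop := fun c => ∃ m, qfTypeEq L' (fun _ : Fin 1 => c) fun _ => q m
  let f' : C → β → M := fun c => if D c then f c else b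
  have hq' : QInconsistent L' φ q f' := by
    intro t ht hc
    refine hq t ht ?_
    have : ∀ l, f' (t l) = f (t l) := by
      intro l
      refine if_pos ⟨l, ?_⟩
      intro ψ hψ
      exact (qf_comp ht (fun _ : Fin 1 => l) ψ hψ).symm
    simpa only [this] using hc
  refine ⟨f', c₀, ?_, if_neg fun ⟨m, hm⟩ => hc₀ m hm, hq', qInconsistent_not_consistent hq'⟩
  intro n l t s c hc hts ψ
  have hc' : ∀ d, ∃ y, c d = b y := fun d => by
    obtain ⟨_, y, _, h⟩ := hc d
    exact ⟨y, h⟩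
  choose y hy using hc'
  have hD : ∀ p, D (t p) ↔ D (s p) := by
    intro p
    have h1 := qf_comp hts (fun _ : Fin 1 => p)
    refine exists_congr fun m => ⟨fun h ψ hψ => (h1 ψ hψ).symm.trans (h ψ hψ),
      fun h ψ hψ => (h1 ψ hψ).trans (h ψ hψ)⟩
  let ρ : Fin n × β ⊕ Fin l → Fin n × β ⊕ A :=
    Sum.elim (fun p => if D (t p.1) then Sum.inl p else Sum.inr ⟨b p.2, hA _⟩)
      fun d => Sum.inr ⟨b (y d), hA _⟩
  have key := indisc_formula hind hts (ψ.relabel ρ)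
  rw [Formula.realize_relabel, Formula.realize_relabel] at key
  refine Iff.trans (iff_of_eq (congrArg ψ.Realize ?_))
    (key.trans (iff_of_eq (congrArg ψ.Realize ?_)))
  · funext z
    rcases z with ⟨p, z⟩ | z
    · by_cases h : D (t p) <;> simp [ρ, f', h]
    · simp [ρ, hy]
  · funext z
    rcases z with ⟨p, z⟩ | z
    · by_cases h : D (t p)
      · have h' := (hD p).1 h
        simp [ρ, f', h, h']
      · have h' : ¬ D (s p) := fun h' => h ((hD p).2 h')
        simp [ρ, f', h, h']
    · simp [ρ, hy]

theorem main_aux {L' : FirstOrder.Language.{u, u}} {C : Type u}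
    [L'.Structure C] {M : Type u} [L.Structure M] [Nonempty M] {α β : Type}
    {φ : L.Formula (α ⊕ β)} {k : ℕ} {q : Fin k → C}
    (x : α → M) (a : ℕ → β → M) (hx : ∀ i, φ.Realize (Sum.elim x (a i)))
    (hdiv : ∀ i : ℕ, ∃ (f : C → β → M) (j₀ : C),
      IndexedIndiscernibleOver (L := L) L' C {m : M | ∃ j x, j < i ∧ m = a j x} f ∧
      f j₀ = a i ∧ QInconsistent L' φ q f) (J : Type u) [LinearOrder J] :
    ∃ (N : Type u) (_ : L.Structure N) (_ : M ↪ₑ[L] N) (b : J → β → N),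
      QIncDividingChain L' C φ q b := by
  classical
  choose f j hind hfj hq using hdiv
  by_cases hcase : ∃ i, ∀ m, ¬ qfTypeEq L' (fun _ : Fin 1 => j (i + 1)) fun _ => q m
  · obtain ⟨i, hi⟩ := hcase
    exact ⟨M, inferInstance, ElementaryEmbedding.refl L M, fun _ => a 0,
      constCase (a 0) (consistent_of_realize x fun _ => hx 0)
        {m : M | ∃ j x, j < i + 1 ∧ m = a j x}
        (fun y => ⟨0, y, Nat.succ_pos i, rfl⟩) (f (i + 1)) (j (i + 1)) hi (hind _) (hq _) J⟩
  · push Not at hcase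
    choose m hm using hcase
    obtain ⟨m₀, hm₀⟩ := Finite.exists_infinite_fiber m
    have hinf : (m ⁻¹' {m₀}).Infinite := Set.infinite_coe_iff.1 hm₀
    let g : ℕ → ℕ := fun n => Nat.nth (· ∈ m ⁻¹' {m₀}) n
    have hg : StrictMono g := Nat.nth_strictMono hinf
    have hgm : ∀ n, m (g n) = m₀ := fun n => Nat.nth_mem_of_infinite hinf n
    let a₁ : ℕ → β → M := fun n => a (g n + 1)
    let A₁ : ℕ → Set M := fun n => {z | ∃ j x, j < n ∧ z = a₁ j x}
    have hA₁ : ∀ n, A₁ n ⊆ {z | ∃ j x, j < g n + 1 ∧ z = a j x} := by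
      rintro n z ⟨l, y, hl, rfl⟩
      exact ⟨g l + 1, y, Nat.succ_lt_succ (hg hl), rfl⟩
    have hind₁ : ∀ n, IndexedIndiscernibleOver (L := L) L' C (A₁ n) (f (g n + 1)) :=
      fun n n' k' t s c hc => hind (g n + 1) n' k' t s c fun d => hA₁ n (hc d)
    obtain ⟨N, S', e', f', hf', hst⟩ := shift (L := L) (q m₀) a₁ A₁ (fun n => f (g n + 1)) (by
      intro n θ hθ
      have h1 := indisc_formula (hind₁ n) (hm (g n))
        (θ.relabel (Sum.elim (fun z => Sum.inr z) fun y => Sum.inl (0, y)))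
      rw [Formula.realize_relabel, Formula.realize_relabel] at h1
      refine (iff_of_eq (congrArg θ.Realize ?_)).mp (h1.2
        ((iff_of_eq (congrArg θ.Realize ?_)).mp hθ))
      · funext z; rcases z with z | z
        · rfl
        · exact congrFun (hfj (g n + 1)) z
      · funext z; rcases z with z | z
        · rfl
        · simp [hgm n])
    have : Nonempty N := ⟨e' (Classical.arbitrary M)⟩
    obtain ⟨N', S'', e'', b, hb⟩ := stretch (L' := L') (φ := φ) (q := q) (q m₀)
      (fun z => e' (x z)) (fun n y => e' (a₁ n y)) f'
      (fun n => by
        have := (e'.map_formula φ (Sum.elim x (a₁ n))).2 (hx _)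
        rwa [Sum.comp_elim] at this)
      (fun n => funext (hf' n))
      (fun n n' k' t s c hc => (hst n).indisc (hind₁ n) n' k' t s c fun d => by
        obtain ⟨l, y, hl, h⟩ := hc d
        exact ⟨⟨a₁ l y, l, y, hl, rfl⟩, h.symm⟩)
      (fun n => (hst n).qInc (hq _)) J
    exact ⟨N', S'', e''.comp e', b, hb⟩

theorem main_aux2 {L' : FirstOrder.Language.{u, u}} {C : Type u}
    [L'.Structure C] {M : Type u} [L.Structure M] [Nonempty M] {α β : Type}
    {φ : L.Formula (α ⊕ β)} {k : ℕ} {q : Fin k → C}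
    (a : ℕ → β → M) (h : QIncDividingChain L' C φ q a) (J : Type u) [LinearOrder J] :
    ∃ (N : Type u) (_ : L.Structure N) (_ : M ↪ₑ[L] N) (b : J → β → N),
      QIncDividingChain L' C φ q b := by
  obtain ⟨⟨⟨E, S, e⟩, x, hx⟩, hdiv⟩ := h
  have : Nonempty E := ⟨e (Classical.arbitrary M)⟩
  obtain ⟨N, S', e', b, hb⟩ := main_aux (L' := L') (q := q) (φ := φ) (M := E) x
    (fun i y => e (a i y)) hx (fun i => by
      obtain ⟨f, j₀, hind, hf, hq, -⟩ := hdiv i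
      have hst : SameType (L := L) (C × β)
          (fun m : {m : M | ∃ j x, j < i ∧ m = a j x} => (m : M)) (fun p => f p.1 p.2)
          (fun m => e (m : M)) (fun p => e (f p.1 p.2)) := by
        intro ψ hψ
        have := (e.map_formula ψ _).2 hψ
        rwa [Sum.comp_elim] at this
      refine ⟨fun c y => e (f c y), j₀, ?_, ?_,
        SameType.qInc (f' := fun c y => e (f c y)) hst hq⟩
      · intro n' k' t s c hc
        refine SameType.indisc (f' := fun c y => e (f c y)) hst hind n' k' t s c fun d => ?_
        obtain ⟨l, y, hl, h⟩ := hc d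
        exact ⟨⟨a l y, l, y, hl, rfl⟩, h.symm⟩
      · funext y
        exact congrArg e (congrFun hf y)) J
  exact ⟨N, S', e'.comp e, b, hb⟩

end Aux

/-- If `φ` admits a `q`-inconsistent `I`-dividing chain of length `ω`, then for
every ordinal (i.e. for every well-ordered index type) `φ` admits a `q`-inconsistent `I`-dividing
chain of that length (in an elementary extension, i.e. in the monster model). -/
theorem statement_5 (L : FirstOrder.Language.{u, u}) (M : Type u) [L.Structure M]
    (L' : FirstOrder.Language.{u, u}) (C : Type u) [L'.Structure C] (lt : L'.Relations 2)
    (hlin : IsStrictTotalOrder C fun a b => Structure.RelMap lt ![a, b])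
    {mx my : ℕ} (φ : L.Formula (Fin mx ⊕ Fin my)) {k : ℕ} (q : Fin k → C)
    (a : ℕ → Fin my → M) (h : QIncDividingChain L' C φ q a)
    (J : Type u) (instJ : LinearOrder J) :
    letI := instJ
    WellFoundedLT J →
      ∃ E : ElemExtension L M,
        letI := E.str
        ∃ b : J → Fin my → E.carrier, QIncDividingChain L' C φ q b := by
  intro _
  have hM : Nonempty M := by
    by_contra hne
    rw [not_nonempty_iff] at hne
    obtain ⟨⟨E, x, hx⟩, hdiv⟩ := h
    obtain ⟨f, j₀, -, -, -, hnc⟩ := hdiv 0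
    refine hnc ⟨E, x, fun c => ?_⟩
    have : f c = a 0 := funext fun y => (hne.false (f c y)).elim
    rw [this]
    exact hx 0
  obtain ⟨N, S, e, b, hb⟩ := main_aux2 a h J
  exact ⟨⟨N, S, e⟩, b, hb⟩

end PaperTP
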